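/- For all unlabeled graphs G, H ∈ 𝒢₀, passing to the jointless versions does not increase distance: d(Ĝ, Ĥ) ≤ d(G, H). -/

import Mathlib

open scoped ENNReal
open Filter Topology

/-- Edges: 2-element subsets of the vertex set `ℕ`. -/
abbrev Edge : Type := {e : Sym2 ℕ // ¬ e.IsDiag}

/-- A labeled graph: an assignment of a real weight to each edge. -/
abbrev LGraph : Type := Edge → ℝ

/-- The norm of a labeled graph: the sum of the absolute values of its edge weights. -/
noncomputable def gnorm (w : LGraph) : ℝ≥0∞ := ∑' e : Edge, ENNReal.ofReal |w e|

/-- A labeled graph has finite norm if its norm is finite. -/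
def FiniteNorm (w : LGraph) : Prop := gnorm w ≠ ⊤

/-- The distance between two labeled graphs: `d(w,w') = |w - w'|`. -/
noncomputable def ldist (w w' : LGraph) : ℝ≥0∞ := ∑' e : Edge, ENNReal.ofReal |w e - w' e|

/-- A vertex is isolated if every edge containing it has weight `0`. -/
def Isolated (w : LGraph) (v : ℕ) : Prop := ∀ e : Edge, v ∈ e.val → w e = 0

/-- A labeled graph is standard if it has infinitely many isolated vertices. -/
def Standard (w : LGraph) : Prop := {v : ℕ | Isolated w v}.Infinite

/-- The image of an edge under a bijection of the vertex set. -/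
def mapEdge (f : ℕ ≃ ℕ) (e : Edge) : Edge :=
  ⟨e.val.map f, fun h => e.prop ((Sym2.isDiag_map f.injective).mp h)⟩

/-- Two labeled graphs are isomorphic if some bijection of the vertices carries the
weights of one to the other: `w(uv) = w'(f(u)f(v))` for all edges `uv`. -/
def GIso (w w' : LGraph) : Prop := ∃ f : ℕ ≃ ℕ, ∀ e : Edge, w e = w' (mapEdge f e)

/-- The isomorphism class of a labeled graph (as a set of labeled graphs). -/
def cls (w : LGraph) : Set LGraph := {w' | GIso w w'}

/-- The distance between the isomorphism classes of two labeled graphs: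
`d(G,G') = inf { d(u,v) : u ∈ G, v ∈ G' }`. -/
noncomputable def Gdist (w₁ w₂ : LGraph) : ℝ≥0∞ := ⨅ u ∈ cls w₁, ⨅ v ∈ cls w₂, ldist u v

/-- A graph is jointless if no two edges of nonzero weight share a vertex. -/
def Jointless (w : LGraph) : Prop :=
  ∀ e e' : Edge, e ≠ e' → w e ≠ 0 → w e' ≠ 0 → ∀ v : ℕ, v ∈ e.val → v ∉ e'.val

/-- Two labeled graphs have the same nonzero edge weights, counted with multiplicity. -/
def SameNonzeroWeights (w w' : LGraph) : Prop :=
  ∃ f : {e : Edge // w e ≠ 0} ≃ {e : Edge // w' e ≠ 0}, ∀ e, w' (f e).val = w e.val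

theorem SameNonzeroWeights.symm {w w' : LGraph} (h : SameNonzeroWeights w w') :
    SameNonzeroWeights w' w := by
  obtain ⟨f, hf⟩ := h
  exact ⟨f.symm, fun e => by rw [← hf, f.apply_symm_apply]⟩

theorem SameNonzeroWeights.trans {w w' w'' : LGraph} (h : SameNonzeroWeights w w')
    (h' : SameNonzeroWeights w' w'') : SameNonzeroWeights w w'' := by
  obtain ⟨f, hf⟩ := h
  obtain ⟨g, hg⟩ := h'
  exact ⟨f.trans g, fun e => by rw [Equiv.trans_apply, hg, hf]⟩

/-- An injection of edges preserving weights and covering the support of the target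
preserves nonzero weights with multiplicity. -/
theorem SameNonzeroWeights.of_injective {w w' : LGraph} {g : Edge → Edge}
    (hg : Function.Injective g) (hw : ∀ e, w' (g e) = w e)
    (hr : ∀ e, w' e ≠ 0 → e ∈ Set.range g) : SameNonzeroWeights w w' := by
  refine ⟨Equiv.ofBijective (fun e => ⟨g e.val, by rw [hw]; exact e.prop⟩) ⟨?_, ?_⟩, ?_⟩
  · intro a b hab
    exact Subtype.ext (hg (congrArg Subtype.val hab))
  · rintro ⟨e, he⟩
    obtain ⟨a, rfl⟩ := hr e he
    exact ⟨⟨a, by rwa [← hw]⟩, rfl⟩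
  · intro e
    exact hw e.val

theorem mapEdge_injective (f : ℕ ≃ ℕ) : Function.Injective (mapEdge f) := by
  intro a b hab
  exact Subtype.ext (Sym2.map.injective f.injective (congrArg Subtype.val hab))

theorem mapEdge_surjective (f : ℕ ≃ ℕ) : Function.Surjective (mapEdge f) := by
  intro e
  refine ⟨mapEdge f.symm e, Subtype.ext ?_⟩
  simp [mapEdge, Sym2.map_map]

theorem GIso.sameNonzeroWeights {w w' : LGraph} (h : GIso w w') : SameNonzeroWeights w w' := by
  obtain ⟨f, hf⟩ := h
  exact .of_injective (mapEdge_injective f) (fun e => (hf e).symm)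
    (fun e _ => mapEdge_surjective f e)

/-- An endpoint of an edge, selected by a Boolean. -/
noncomputable def endpoint (e : Edge) (b : Bool) : ℕ :=
  bif b then (Quot.out e.val).1 else (Quot.out e.val).2

theorem mk_endpoint (e : Edge) : s(endpoint e true, endpoint e false) = e.val :=
  Quot.out_eq e.val

theorem endpoint_mem (e : Edge) (b : Bool) : endpoint e b ∈ e.val := by
  rw [← mk_endpoint e]
  cases b <;> simp

theorem endpoint_injective (e : Edge) : Function.Injective (endpoint e) := by
  have h : endpoint e true ≠ endpoint e false := fun h =>
    e.prop (by rw [← mk_endpoint e]; exact h)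
  intro b c hbc
  cases b <;> cases c <;> simp_all

/-- The endpoints of the edges of nonzero weight. -/
noncomputable def supportEndpoint (w : LGraph) (x : {e : Edge // w e ≠ 0} × Bool) : ℕ :=
  endpoint x.1.val x.2

theorem Jointless.supportEndpoint_injective {w : LGraph} (h : Jointless w) :
    Function.Injective (supportEndpoint w) := by
  rintro ⟨⟨e, he⟩, b⟩ ⟨⟨e', he'⟩, b'⟩ hx
  change endpoint e b = endpoint e' b' at hx
  have hee : e = e' := by
    by_contra hne
    exact h e e' hne he he' _ (endpoint_mem e b) (hx ▸ endpoint_mem e' b')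
  subst hee
  rw [endpoint_injective e hx]

theorem Standard.infinite_compl_range {w : LGraph} (h : Standard w) :
    (Set.range (supportEndpoint w))ᶜ.Infinite := by
  refine h.mono ?_
  rintro v hv ⟨x, rfl⟩
  exact x.1.prop (hv _ (endpoint_mem _ _))

/-- Standard jointless graphs are determined up to isomorphism by their nonzero weights. -/
theorem GIso.of_jointless {w w' : LGraph} (hs : Standard w) (hj : Jointless w)
    (hs' : Standard w') (hj' : Jointless w') (h : SameNonzeroWeights w w') : GIso w w' := by
  classical
  obtain ⟨F, hF⟩ := h
  have := hs.infinite_compl_range.to_subtype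
  have := hs'.infinite_compl_range.to_subtype
  obtain ⟨c⟩ := nonempty_equiv_of_countable (α := ↥(Set.range (supportEndpoint w))ᶜ)
    (β := ↥(Set.range (supportEndpoint w'))ᶜ)
  let r : Set.range (supportEndpoint w) ≃ Set.range (supportEndpoint w') :=
    ((Equiv.ofInjective _ hj.supportEndpoint_injective).symm.trans
      (F.prodCongr (Equiv.refl Bool))).trans (Equiv.ofInjective _ hj'.supportEndpoint_injective)
  let f : ℕ ≃ ℕ := ((Equiv.Set.sumCompl _).symm.trans (r.sumCongr c)).trans (Equiv.Set.sumCompl _)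
  have hf : ∀ e b, f (endpoint e.val b) = endpoint (F e).val b := by
    intro e b
    have hx : endpoint e.val b ∈ Set.range (supportEndpoint w) := ⟨(e, b), rfl⟩
    have hr : r ⟨endpoint e.val b, hx⟩ = ⟨endpoint (F e).val b, (F e, b), rfl⟩ := by
      have : (⟨endpoint e.val b, hx⟩ : Set.range (supportEndpoint w)) =
          Equiv.ofInjective _ hj.supportEndpoint_injective (e, b) := rfl
      simp only [r, this, Equiv.trans_apply, Equiv.symm_apply_apply]
      rfl
    simp only [f, Equiv.trans_apply, Equiv.Set.sumCompl_symm_apply_of_mem hx,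
      Equiv.sumCongr_apply, Sum.map_inl, hr, Equiv.Set.sumCompl_apply_inl]
  have hmap : ∀ e : {e : Edge // w e ≠ 0}, mapEdge f e.val = (F e).val := by
    intro e
    apply Subtype.ext
    rw [← mk_endpoint (F e).val, ← hf, ← hf]
    change Sym2.map f e.val.val = _
    rw [← mk_endpoint e.val, Sym2.map_mk]
  refine ⟨f, fun e => ?_⟩
  by_cases he : w e = 0
  · by_contra hne
    obtain ⟨e₀, h₀⟩ := F.surjective ⟨mapEdge f e, fun h => hne (he.trans h.symm)⟩
    have h₁ := hmap e₀
    rw [h₀] at h₁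
    exact e₀.prop (mapEdge_injective f h₁ ▸ he)
  · rw [hmap ⟨e, he⟩, hF]

/-- An injection of the edges onto a perfect matching of the vertices congruent to `0` or `1`
modulo `4`. -/
noncomputable def matchingEdge (e : Edge) : Edge :=
  ⟨s(4 * (exists_injective_nat Edge).choose e, 4 * (exists_injective_nat Edge).choose e + 1),
    by simp⟩

theorem eq_of_mem_matchingEdge {e e' : Edge} {v : ℕ} (h : v ∈ (matchingEdge e).val)
    (h' : v ∈ (matchingEdge e').val) : e = e' := by
  apply (exists_injective_nat Edge).choose_spec
  simp only [matchingEdge, Sym2.mem_iff] at h h'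
  omega

theorem matchingEdge_injective : Function.Injective matchingEdge := fun e _ h =>
  eq_of_mem_matchingEdge (endpoint_mem (matchingEdge e) true)
    (h ▸ endpoint_mem (matchingEdge e) true)

/-- The jointless graph carrying the weights of `w` on the matching edges. -/
noncomputable def hat (w : LGraph) : LGraph := Function.extend matchingEdge w 0

theorem hat_matchingEdge (w : LGraph) (e : Edge) : hat w (matchingEdge e) = w e :=
  matchingEdge_injective.extend_apply _ _ _

theorem hat_eq_zero (w : LGraph) {e : Edge} (h : e ∉ Set.range matchingEdge) : hat w e = 0 :=
  Function.extend_apply' _ _ _ h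

theorem mem_range_of_hat_ne_zero {w : LGraph} {e : Edge} (h : hat w e ≠ 0) :
    e ∈ Set.range matchingEdge := by
  by_contra hn
  exact h (hat_eq_zero w hn)

theorem hat_sameNonzeroWeights (w : LGraph) : SameNonzeroWeights w (hat w) :=
  .of_injective matchingEdge_injective (hat_matchingEdge w) fun _ => mem_range_of_hat_ne_zero

theorem hat_jointless (w : LGraph) : Jointless (hat w) := by
  intro e e' hne he he' v hv hv'
  obtain ⟨a, rfl⟩ := mem_range_of_hat_ne_zero he
  obtain ⟨b, rfl⟩ := mem_range_of_hat_ne_zero he'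
  exact hne (congrArg _ (eq_of_mem_matchingEdge hv hv'))

theorem hat_standard (w : LGraph) : Standard (hat w) := by
  refine Set.infinite_of_injective_forall_mem (f := fun n : ℕ => 4 * n + 2)
    (fun a b h => by simpa using h) ?_
  intro n e hn
  by_contra he
  obtain ⟨a, rfl⟩ := mem_range_of_hat_ne_zero he
  simp only [matchingEdge, Sym2.mem_iff] at hn
  omega

theorem ldist_hat (u v : LGraph) : ldist (hat u) (hat v) = ldist u v := by
  unfold ldist
  rw [← matchingEdge_injective.tsum_eq (f := fun e => ENNReal.ofReal |hat u e - hat v e|)]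
  · simp only [hat_matchingEdge]
  · intro e he
    by_contra hn
    simp [hat_eq_zero _ hn] at he

theorem hat_mem_cls {w wh u : LGraph} (hu : u ∈ cls w)
    (hh : Standard wh ∧ Jointless wh ∧ SameNonzeroWeights w wh) : hat u ∈ cls wh :=
  GIso.of_jointless hh.1 hh.2.1 (hat_standard u) (hat_jointless u)
    (hh.2.2.symm.trans (GIso.sameNonzeroWeights hu |>.trans (hat_sameNonzeroWeights u)))

/-- Passing to the jointless versions does not increase distance: `d(Ĝ,Ĥ) ≤ d(G,H)`. -/
theorem hat_dist_le (w₁ w₂ wh₁ wh₂ : LGraph)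
    (hs₁ : Standard w₁) (hf₁ : FiniteNorm w₁) (hs₂ : Standard w₂) (hf₂ : FiniteNorm w₂)
    (hh₁ : Standard wh₁ ∧ Jointless wh₁ ∧ SameNonzeroWeights w₁ wh₁)
    (hh₂ : Standard wh₂ ∧ Jointless wh₂ ∧ SameNonzeroWeights w₂ wh₂) :
    Gdist wh₁ wh₂ ≤ Gdist w₁ w₂ := by
  refine le_iInf₂ fun u hu => le_iInf₂ fun v hv => ?_
  rw [← ldist_hat u v]
  exact (iInf₂_le (hat u) (hat_mem_cls hu hh₁)).trans (iInf₂_le (hat v) (hat_mem_cls hv hh₂))
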